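/- arXiv:2408.07235 — 4 statements merged into one kernel-verified Lean document; each statement's English description precedes it below -/
import Mathlib

section
/- Let H be a real Hilbert space, let f and g be proper lower semicontinuous convex functions from H to (−∞,+∞], and let γ > 0. If the Moreau envelopes of index γ of f and g coincide, i.e. env_γ f = env_γ g, then f = g. -/
open scoped RealInnerProductSpace
open Filter Set

noncomputable section

/-- Fenchel (Legendre) conjugate of an extended-real-valued function. -/
def fconj {H : Type*} [NormedAddCommGroup H] [InnerProductSpace ℝ H]
    (f : H → EReal) : H → EReal :=
  fun xs => ⨆ x : H, (⟪x, xs⟫ : EReal) - f x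

/-- Moreau envelope of index `γ`. -/
def menv {H : Type*} [NormedAddCommGroup H] (γ : ℝ) (f : H → EReal) : H → EReal :=
  fun x => ⨅ y : H, f y + ((‖x - y‖ ^ 2 / (2 * γ) : ℝ) : EReal)

/-- Quadratic kernel `Q`. -/
def qk {H : Type*} [NormedAddCommGroup H] (x : H) : ℝ := ‖x‖ ^ 2 / 2

/-- Proximal composition `L ⊙_γ g`. -/
def proxComp {H G : Type*} [NormedAddCommGroup H] [InnerProductSpace ℝ H]
    [NormedAddCommGroup G] [InnerProductSpace ℝ G]
    (L : H →L[ℝ] G) (γ : ℝ) (g : G → EReal) : H → EReal :=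
  fun x => fconj (fun z => menv (1 / γ) (fconj g) (L z)) x - (((1 / γ) * qk x : ℝ) : EReal)

/-- Proximal cocomposition `L ⊚_γ g`. -/
def proxCocomp {H G : Type*} [NormedAddCommGroup H] [InnerProductSpace ℝ H]
    [NormedAddCommGroup G] [InnerProductSpace ℝ G]
    (L : H →L[ℝ] G) (γ : ℝ) (g : G → EReal) : H → EReal :=
  fconj (proxComp L (1 / γ) (fconj g))

/-- `f` is proper: not identically `+∞` and never `−∞`. -/
def ProperE {H : Type*} (f : H → EReal) : Prop :=
  (∃ x, f x ≠ ⊤) ∧ ∀ x, f x ≠ ⊥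

/-- `f` admits a continuous affine minorant. -/
def HasAffMinorant {H : Type*} [NormedAddCommGroup H] [InnerProductSpace ℝ H]
    (f : H → EReal) : Prop :=
  ∃ (u : H) (c : ℝ), ∀ x, ((⟪x, u⟫ + c : ℝ) : EReal) ≤ f x

/-- Convexity for extended-real-valued functions. -/
def ConvexE {H : Type*} [NormedAddCommGroup H] [InnerProductSpace ℝ H]
    (f : H → EReal) : Prop :=
  ∀ x y : H, ∀ a b : ℝ, 0 < a → 0 < b → a + b = 1 →
    f (a • x + b • y) ≤ ((a : ℝ) : EReal) * f x + ((b : ℝ) : EReal) * f y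

/-- The class `Γ₀`: proper, lower semicontinuous, convex. -/
def IsGamma0 {H : Type*} [NormedAddCommGroup H] [InnerProductSpace ℝ H]
    (f : H → EReal) : Prop :=
  ProperE f ∧ LowerSemicontinuous f ∧ ConvexE f

/-- `p` is a proximal point of `f` at `x`. -/
def IsProx {H : Type*} [NormedAddCommGroup H] (f : H → EReal) (x p : H) : Prop :=
  ∀ y : H, f p + ((‖x - p‖ ^ 2 / 2 : ℝ) : EReal) ≤ f y + ((‖x - y‖ ^ 2 / 2 : ℝ) : EReal)

/-- Subdifferential. -/
def SubdiffE {H : Type*} [NormedAddCommGroup H] [InnerProductSpace ℝ H]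
    (f : H → EReal) (x : H) : Set H :=
  {xs | ∀ y : H, (⟪y - x, xs⟫ : EReal) + f x ≤ f y}

/-- Recession function. -/
def recE {H : Type*} [NormedAddCommGroup H] (f : H → EReal) : H → EReal :=
  fun x => ⨆ y : {y : H // f y ≠ ⊤}, f (x + (y : H)) - f (y : H)

end

theorem ConvexE.convex_epigraph {H : Type*} [NormedAddCommGroup H] [InnerProductSpace ℝ H]
    {f : H → EReal} (hf : ConvexE f) : Convex ℝ {p : H × ℝ | f p.1 ≤ (p.2 : EReal)} := by
  rw [convex_iff_forall_pos]
  rintro ⟨x, s⟩ hx ⟨y, t⟩ hy a b ha hb hab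
  simp only [mem_ofPred_eq] at hx hy
  have ha' : (0 : EReal) ≤ a := EReal.coe_nonneg.2 ha.le
  have hb' : (0 : EReal) ≤ b := EReal.coe_nonneg.2 hb.le
  change f (a • x + b • y) ≤ ((a * s + b * t : ℝ) : EReal)
  refine (hf x y a b ha hb hab).trans ?_
  rw [EReal.coe_add, EReal.coe_mul, EReal.coe_mul]
  exact add_le_add (mul_le_mul_of_nonneg_left hx ha') (mul_le_mul_of_nonneg_left hy hb')

theorem LowerSemicontinuous.isClosed_real_epigraph {H : Type*} [TopologicalSpace H]
    {f : H → EReal} (hf : LowerSemicontinuous f) :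
    IsClosed {p : H × ℝ | f p.1 ≤ (p.2 : EReal)} :=
  hf.isClosed_epigraph.preimage
    (continuous_fst.prodMk (continuous_coe_real_ereal.comp continuous_snd))

/-- A point strictly below the graph of a function in `Γ₀(H)` is strictly separated from its
epigraph by a hyperplane which is either vertical or the graph of an affine minorant. -/
theorem IsGamma0.exists_separation {H : Type*} [NormedAddCommGroup H] [InnerProductSpace ℝ H]
    [CompleteSpace H] {f : H → EReal} (hf : IsGamma0 f) {x₀ : H} {t : ℝ} (ht : (t : EReal) < f x₀) :
    ∃ (v : H) (s c : ℝ), 0 ≤ s ∧ ⟪x₀, v⟫ + s * t < c ∧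
      ∀ (x : H) (r : ℝ), f x ≤ (r : EReal) → c < ⟪x, v⟫ + s * r := by
  obtain ⟨φ, c, h₁, h₂⟩ := geometric_hahn_banach_point_closed (x := (x₀, t))
    hf.2.2.convex_epigraph hf.2.1.isClosed_real_epigraph (by simpa using ht)
  set v := (InnerProductSpace.toDual ℝ H).symm (φ.comp (ContinuousLinearMap.inl ℝ H ℝ))
  have hφ (x : H) (r : ℝ) : φ (x, r) = ⟪x, v⟫ + φ (0, 1) * r := by
    have hv : ⟪x, v⟫ = φ (x, 0) := by
      rw [real_inner_comm, InnerProductSpace.toDual_symm_apply]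
      simp
    have hr : φ (0, r) = φ (0, 1) * r := by
      rw [mul_comm, ← smul_eq_mul, ← map_smul]
      simp
    rw [hv, ← hr, ← map_add]
    simp
  have h_epi (x : H) (r : ℝ) (hr : f x ≤ (r : EReal)) : c < ⟪x, v⟫ + φ (0, 1) * r :=
    (h₂ (x, r) hr).trans_eq (hφ x r)
  refine ⟨v, φ (0, 1), c, ?_, (hφ x₀ t).symm.trans_lt h₁, h_epi⟩
  obtain ⟨y, hy⟩ := hf.1.1
  by_contra! hs
  set s := φ (0, 1)
  have hr : f y ≤ ((max (f y).toReal ((c - ⟪y, v⟫) / s) : ℝ) : EReal) :=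
    (EReal.le_coe_toReal hy).trans (EReal.coe_le_coe_iff.2 (le_max_left _ _))
  have h₃ := h_epi y _ hr
  have h₄ := mul_le_mul_of_nonpos_left (le_max_right (f y).toReal ((c - ⟪y, v⟫) / s)) hs.le
  rw [mul_div_cancel₀ _ hs.ne] at h₄
  linarith

theorem le_of_forall_real_ge {a : ℝ} {b : EReal} (hb : b ≠ ⊥)
    (h : ∀ r : ℝ, b ≤ (r : EReal) → a ≤ r) : (a : EReal) ≤ b := by
  induction b with
  | bot => exact absurd rfl hb
  | top => exact le_top
  | coe b => exact EReal.coe_le_coe_iff.2 (h b le_rfl)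

/-- The separating hyperplane at a point of the domain is not vertical. -/
theorem IsGamma0.hasAffMinorant {H : Type*} [NormedAddCommGroup H] [InnerProductSpace ℝ H]
    [CompleteSpace H] {f : H → EReal} (hf : IsGamma0 f) : HasAffMinorant f := by
  obtain ⟨y, hy⟩ := hf.1.1
  have hfy : f y = ((f y).toReal : EReal) := (EReal.coe_toReal hy (hf.1.2 y)).symm
  have hlt : (((f y).toReal - 1 : ℝ) : EReal) < f y := by
    rw [hfy, EReal.coe_lt_coe_iff, EReal.toReal_coe]
    linarith
  obtain ⟨v, s, c, -, h₁, h₂⟩ := hf.exists_separation hlt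
  have hs : 0 < s := by linarith [h₂ y _ hfy.le]
  refine ⟨-s⁻¹ • v, c / s, fun x => le_of_forall_real_ge (hf.1.2 x) fun r hr => ?_⟩
  rw [inner_smul_right, neg_mul, inv_mul_eq_div, neg_add_eq_sub, ← sub_div, div_le_iff₀ hs]
  linarith [h₂ x r hr]

/-- A function in `Γ₀(H)` is the supremum of its continuous affine minorants. -/
theorem IsGamma0.exists_affine_minorant_gt {H : Type*} [NormedAddCommGroup H]
    [InnerProductSpace ℝ H] [CompleteSpace H] {f : H → EReal} (hf : IsGamma0 f) {x₀ : H} {t : ℝ}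
    (ht : (t : EReal) < f x₀) :
    ∃ (u : H) (c : ℝ), (∀ x, ((⟪x, u⟫ + c : ℝ) : EReal) ≤ f x) ∧ t < ⟪x₀, u⟫ + c := by
  obtain ⟨v, s, c, hs, h₁, h₂⟩ := hf.exists_separation ht
  rcases hs.eq_or_lt with rfl | hs
  · obtain ⟨u, d, hu⟩ := hf.hasAffMinorant
    simp only [zero_mul, add_zero] at h₁ h₂
    obtain ⟨n, hn⟩ := exists_nat_gt ((t - (⟪x₀, u⟫ + d)) / (c - ⟪x₀, v⟫))
    rw [div_lt_iff₀ (sub_pos.2 h₁)] at hn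
    refine ⟨u - (n : ℝ) • v, d + n * c,
      fun x => le_of_forall_real_ge (hf.1.2 x) fun r hr => ?_, ?_⟩
    · have h₃ := EReal.coe_le_coe_iff.1 ((hu x).trans hr)
      have h₄ := mul_le_mul_of_nonneg_left (h₂ x r hr).le (Nat.cast_nonneg (α := ℝ) n)
      rw [inner_sub_right, inner_smul_right]
      linarith
    · rw [inner_sub_right, inner_smul_right]
      linarith
  · refine ⟨-s⁻¹ • v, c / s, fun x => le_of_forall_real_ge (hf.1.2 x) fun r hr => ?_, ?_⟩ <;>
      rw [inner_smul_right, neg_mul, inv_mul_eq_div, neg_add_eq_sub, ← sub_div]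
    · rw [div_le_iff₀ hs]
      linarith [h₂ x r hr]
    · rw [lt_div_iff₀ hs]
      linarith

theorem affine_le_menv {H : Type*} [NormedAddCommGroup H] [InnerProductSpace ℝ H]
    {f : H → EReal} {γ : ℝ} (hγ : 0 < γ) {u : H} {c : ℝ}
    (hu : ∀ x, ((⟪x, u⟫ + c : ℝ) : EReal) ≤ f x) (x : H) :
    ((⟪x, u⟫ + c - γ * ‖u‖ ^ 2 / 2 : ℝ) : EReal) ≤ menv γ f x := by
  refine le_iInf fun y => le_trans ?_ (add_le_add_left (hu y) _)
  rw [← EReal.coe_add, EReal.coe_le_coe_iff]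
  have h : 0 ≤ ‖(x - y) - γ • u‖ ^ 2 / (2 * γ) := by positivity
  rw [norm_sub_sq_real, inner_smul_right, norm_smul, Real.norm_of_nonneg hγ.le,
    inner_sub_left] at h
  have h' : (‖x - y‖ ^ 2 - 2 * (γ * (⟪x, u⟫ - ⟪y, u⟫)) + (γ * ‖u‖) ^ 2) / (2 * γ) =
      ‖x - y‖ ^ 2 / (2 * γ) - (⟪x, u⟫ - ⟪y, u⟫) + γ * ‖u‖ ^ 2 / 2 := by
    field_simp
  linarith

theorem affine_le_of_le_menv {H : Type*} [NormedAddCommGroup H] [InnerProductSpace ℝ H]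
    {g : H → EReal} {γ : ℝ} (hγ : 0 < γ) {u : H} {c : ℝ}
    (hu : ∀ x, ((⟪x, u⟫ + c - γ * ‖u‖ ^ 2 / 2 : ℝ) : EReal) ≤ menv γ g x) (y : H) :
    ((⟪y, u⟫ + c : ℝ) : EReal) ≤ g y := by
  have h := (hu (y + γ • u)).trans (iInf_le _ y)
  have hq : ‖y + γ • u - y‖ ^ 2 / (2 * γ) = γ * ‖u‖ ^ 2 / 2 := by
    rw [add_sub_cancel_left, norm_smul, Real.norm_of_nonneg hγ.le]
    field_simp
  have hp : ⟪y + γ • u, u⟫ + c - γ * ‖u‖ ^ 2 / 2 = ⟪y, u⟫ + c + γ * ‖u‖ ^ 2 / 2 := by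
    rw [inner_add_left, real_inner_smul_left, real_inner_self_eq_norm_sq]
    ring
  rw [hq, hp, EReal.coe_add] at h
  exact le_of_not_gt fun hlt => (EReal.add_lt_add_right_coe hlt _).not_ge h

theorem IsGamma0.le_of_menv_le {H : Type*} [NormedAddCommGroup H] [InnerProductSpace ℝ H]
    [CompleteSpace H] {f g : H → EReal} (hf : IsGamma0 f) {γ : ℝ} (hγ : 0 < γ)
    (h : menv γ f ≤ menv γ g) : f ≤ g := by
  intro x
  by_contra! hlt
  obtain ⟨t, hgt, htf⟩ := EReal.lt_iff_exists_real_btwn.1 hlt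
  obtain ⟨u, c, hu, htu⟩ := hf.exists_affine_minorant_gt htf
  have hg := affine_le_of_le_menv hγ (fun z => (affine_le_menv hγ hu z).trans (h z)) x
  exact (hgt.trans (EReal.coe_lt_coe_iff.2 htu)).not_ge hg

/-- If two functions in `Γ₀(H)` have the same Moreau envelope of index `γ > 0`,
then they are equal. -/
theorem moreau_envelope_injective
    {H : Type*} [NormedAddCommGroup H] [InnerProductSpace ℝ H] [CompleteSpace H]
    (f g : H → EReal) (hf : IsGamma0 f) (hg : IsGamma0 g)
    (γ : ℝ) (hγ : 0 < γ) (h : menv γ f = menv γ g) : f = g := by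
  exact le_antisymm (hf.le_of_menv_le hγ h.le) (hg.le_of_menv_le hγ h.ge)
end

section
/- Let L ∈ B(H,G), let g : G → (−∞,+∞] be proper with a continuous affine minorant, let γ > 0, and set Φ = Q_G − Q_H ∘ L*. Then for every x ∈ H, (L ⊙_γ g)(x) = inf { g**(y) + Φ(y)/γ : y ∈ G, L*y = x }, and whenever this infimum is finite it is attained. Consequently the effective domain of L ⊙_γ g is L*(dom g**). -/
open scoped RealInnerProductSpace
open Filter Set

theorem EReal.coe_sub_le_coe_iff (a r : ℝ) (x : EReal) :
    (a : EReal) - x ≤ r ↔ ((a - r : ℝ) : EReal) ≤ x := by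
  induction x with
  | bot => simp [sub_eq_add_neg, -EReal.coe_neg, -EReal.coe_add]
  | top => simp
  | coe x => norm_cast; constructor <;> intro h <;> linarith

theorem EReal.coe_le_of_forall_real_ge {a : ℝ} {x : EReal}
    (h : ∀ r : ℝ, x ≤ r → a ≤ r) : (a : EReal) ≤ x := by
  induction x with
  | bot => linarith [h (a - 1) bot_le]
  | top => exact le_top
  | coe x => exact_mod_cast h x le_rfl

theorem LinearMap.eq_zero_of_bddBelow {E : Type*} [AddCommGroup E] [Module ℝ E]
    (φ : E →ₗ[ℝ] ℝ) {c : ℝ} (h : ∀ z, c ≤ φ z) (z : E) : φ z = 0 := by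
  by_contra hz
  have h' := h (((c - 1) / φ z) • z)
  rw [map_smul, smul_eq_mul, div_mul_cancel₀ _ hz] at h'
  linarith

theorem coe_le_menv_iff {G : Type*} [NormedAddCommGroup G] (f : G → EReal) (γ a : ℝ)
    (w : G) :
    (a : EReal) ≤ menv (1 / γ) f w ↔
      ∀ (v : G) (r : ℝ), f v ≤ r → a ≤ r + γ / 2 * ‖w - v‖ ^ 2 := by
  have hq (v : G) : ‖w - v‖ ^ 2 / (2 * (1 / γ)) = γ / 2 * ‖w - v‖ ^ 2 := by
    simp only [div_eq_mul_inv, mul_inv, inv_inv]; ring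
  simp only [menv, le_iInf_iff, hq]
  refine forall_congr' fun v => ⟨fun h r hr => ?_, fun h => ?_⟩
  · exact_mod_cast h.trans (add_le_add_left hr _)
  · generalize γ / 2 * ‖w - v‖ ^ 2 = k at *
    have h' : ((a - k : ℝ) : EReal) ≤ f v :=
      EReal.coe_le_of_forall_real_ge fun r hr => by linarith [h r hr]
    calc (a : EReal) = ((a - k : ℝ) : EReal) + (k : EReal) := by norm_cast; ring
      _ ≤ _ := add_le_add_left h' _

theorem isOpen_strictEpi_menv {G : Type*} [NormedAddCommGroup G] (f : G → EReal)
    (γ : ℝ) :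
    IsOpen {p : G × ℝ | ∃ (v : G) (r : ℝ), f v ≤ r ∧
      r + γ / 2 * ‖p.1 - v‖ ^ 2 < p.2} := by
  simp only [Set.ofPred_exists, Set.ofPred_and]
  refine isOpen_iUnion fun v => isOpen_iUnion fun r => isOpen_const.inter ?_
  exact isOpen_lt (by fun_prop) (by fun_prop)

section Conjugation

variable {H G : Type*} [NormedAddCommGroup H] [InnerProductSpace ℝ H]
  [NormedAddCommGroup G] [InnerProductSpace ℝ G]

theorem fconj_le_coe_iff (f : H → EReal) (u : H) (r : ℝ) :
    fconj f u ≤ r ↔ ∀ x, ((⟪x, u⟫ - r : ℝ) : EReal) ≤ f x := by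
  simp only [fconj, iSup_le_iff, EReal.coe_sub_le_coe_iff]

/-- The epigraph of a Fenchel conjugate is convex. -/
theorem fconj_combo_le (f : H → EReal) {u v : H} {r s a b : ℝ} (hu : fconj f u ≤ r)
    (hv : fconj f v ≤ s) (ha : 0 ≤ a) (hb : 0 ≤ b) (hab : a + b = 1) :
    fconj f (a • u + b • v) ≤ ((a * r + b * s : ℝ) : EReal) := by
  rw [fconj_le_coe_iff] at *
  intro x
  have key : ⟪x, a • u + b • v⟫ - (a * r + b * s)
      = a * (⟪x, u⟫ - r) + b * (⟪x, v⟫ - s) := by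
    rw [inner_add_right, inner_smul_right, inner_smul_right]; ring
  rw [key]
  refine EReal.coe_le_of_forall_real_ge fun t ht => ?_
  have h1 : ⟪x, u⟫ - r ≤ t := by exact_mod_cast (hu x).trans ht
  have h2 : ⟪x, v⟫ - s ≤ t := by exact_mod_cast (hv x).trans ht
  calc a * (⟪x, u⟫ - r) + b * (⟪x, v⟫ - s) ≤ a * t + b * t := by gcongr
    _ = t := by rw [← add_mul, hab, one_mul]

theorem fconj_menv_comp_le_coe_iff (L : H →L[ℝ] G) (f : G → EReal) (γ s : ℝ) (x : H) :
    fconj (fun z => menv (1 / γ) f (L z)) x ≤ s ↔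
      ∀ (z : H) (v : G) (r : ℝ), f v ≤ r → ⟪z, x⟫ - s ≤ r + γ / 2 * ‖L z - v‖ ^ 2 := by
  simp only [fconj_le_coe_iff, coe_le_menv_iff]

theorem convex_strictEpi_menv_fconj (g : G → EReal) {γ : ℝ} (hγ : 0 < γ) :
    Convex ℝ {p : G × ℝ | ∃ (v : G) (r : ℝ), fconj g v ≤ r ∧
      r + γ / 2 * ‖p.1 - v‖ ^ 2 < p.2} := by
  rintro ⟨w₁, t₁⟩ ⟨v₁, r₁, h₁, k₁⟩ ⟨w₂, t₂⟩ ⟨v₂, r₂, h₂, k₂⟩ a b ha hb hab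
  refine ⟨a • v₁ + b • v₂, a * r₁ + b * r₂, fconj_combo_le g h₁ h₂ ha hb hab, ?_⟩
  simp only [Prod.smul_mk, Prod.mk_add_mk, smul_eq_mul] at k₁ k₂ ⊢
  have hsplit : a • w₁ + b • w₂ - (a • v₁ + b • v₂) = a • (w₁ - v₁) + b • (w₂ - v₂) := by
    module
  have hsq : ‖a • (w₁ - v₁) + b • (w₂ - v₂)‖ ^ 2 ≤ a * ‖w₁ - v₁‖ ^ 2 + b * ‖w₂ - v₂‖ ^ 2 := by
    have h := (convexOn_norm (convex_univ (E := G) (𝕜 := ℝ))).pow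
      (fun _ _ => norm_nonneg _) 2
    simpa using h.2 (mem_univ (w₁ - v₁)) (mem_univ (w₂ - v₂)) ha hb hab
  rw [hsplit]
  have hle : a * r₁ + b * r₂ + γ / 2 * ‖a • (w₁ - v₁) + b • (w₂ - v₂)‖ ^ 2 ≤
      a * (r₁ + γ / 2 * ‖w₁ - v₁‖ ^ 2) + b * (r₂ + γ / 2 * ‖w₂ - v₂‖ ^ 2) := by
    nlinarith
  refine hle.trans_lt ?_
  rcases ha.eq_or_lt with rfl | ha
  · obtain rfl : b = 1 := by linarith
    linarith
  · exact add_lt_add_of_lt_of_le (mul_lt_mul_of_pos_left k₁ ha)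
      (mul_le_mul_of_nonneg_left k₂.le hb)

variable [CompleteSpace H] [CompleteSpace G]

/-- Hahn–Banach sandwich: an affine minorant of `env (g*) ∘ L` is induced by an affine minorant
of `env (g*)`. -/
theorem exists_adjoint_eq_of_le_menv (L : H →L[ℝ] G) (g : G → EReal) {γ : ℝ} (hγ : 0 < γ)
    {v₀ : G} {r₀ : ℝ} (hv₀ : fconj g v₀ ≤ r₀) {x : H} {s : ℝ}
    (hs : ∀ (z : H) (v : G) (r : ℝ), fconj g v ≤ r → ⟪z, x⟫ - s ≤ r + γ / 2 * ‖L z - v‖ ^ 2) :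
    ∃ y : G, ContinuousLinearMap.adjoint L y = x ∧
      ∀ (w v : G) (r : ℝ), fconj g v ≤ r → ⟪w, y⟫ - s ≤ r + γ / 2 * ‖w - v‖ ^ 2 := by
  let S : Set (G × ℝ) := {p | ∃ (v : G) (r : ℝ), fconj g v ≤ r ∧
    r + γ / 2 * ‖p.1 - v‖ ^ 2 < p.2}
  let A : H →ₗ[ℝ] G × ℝ := L.toLinearMap.prod (innerₗ H x)
  have hA (z : H) : A z = (L z, ⟪z, x⟫) := by simp [A, real_inner_comm]
  let T : Set (G × ℝ) := (fun q => (0, -s) + q) '' (LinearMap.range A : Set (G × ℝ))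
  have hT : Convex ℝ T := (LinearMap.range A).convex.translate _
  have hdisj : Disjoint S T := by
    rw [Set.disjoint_left]
    rintro _ ⟨v, r, hv, hlt⟩ ⟨_, ⟨z, rfl⟩, rfl⟩
    have := hs z v r hv
    simp only [hA, Prod.mk_add_mk, zero_add] at hlt
    linarith
  obtain ⟨φ, c, hφS, hφT⟩ := geometric_hahn_banach_open
    (convex_strictEpi_menv_fconj g hγ) (isOpen_strictEpi_menv (fconj g) γ) hT hdisj
  set q : ℝ := φ (0, 1)
  set p : G := (InnerProductSpace.toDual ℝ G).symm (φ.comp (ContinuousLinearMap.inl ℝ G ℝ))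
  have hφ (w : G) (t : ℝ) : φ (w, t) = ⟪w, p⟫ + t * q := by
    have h1 : ⟪w, p⟫ = φ (w, 0) := by
      rw [real_inner_comm, InnerProductSpace.toDual_symm_apply]; simp
    have h2 : ((w, t) : G × ℝ) = (w, 0) + t • (0, 1) := by simp
    rw [h2, map_add, map_smul, h1, smul_eq_mul]
  have hbd (z : H) : c + s * q ≤ φ (A z) := by
    have := hφT _ ⟨A z, ⟨z, rfl⟩, rfl⟩
    rw [map_add, hφ 0] at this
    simp only [inner_zero_left] at this
    linarith
  have hzero (z : H) : ⟪L z, p⟫ + ⟪z, x⟫ * q = 0 := by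
    rw [← hφ, ← hA]
    exact LinearMap.eq_zero_of_bddBelow (φ.toLinearMap.comp A) hbd z
  have hc : c ≤ -s * q := by
    have := hbd 0
    simp only [map_zero] at this
    linarith
  have hup (t : ℝ) (ht : r₀ + γ / 2 * ‖(0 : G) - v₀‖ ^ 2 < t) : t * q < -s * q := by
    have := hφS (0, t) ⟨v₀, r₀, hv₀, ht⟩
    rw [hφ, inner_zero_left] at this
    linarith
  have hqneg : q < 0 := by
    have h := hup (max (r₀ + γ / 2 * ‖(0 : G) - v₀‖ ^ 2) (-s) + 1)
      (lt_add_of_le_of_pos (le_max_left _ _) one_pos)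
    by_contra! hq0
    have := mul_le_mul_of_nonneg_right
      ((le_max_right (r₀ + γ / 2 * ‖(0 : G) - v₀‖ ^ 2) (-s)).trans (lt_add_one _).le) hq0
    linarith
  refine ⟨(-q⁻¹) • p, ext_inner_left ℝ fun z => ?_, fun w v r hv => ?_⟩
  · rw [ContinuousLinearMap.adjoint_inner_right, inner_smul_right,
      eq_neg_of_add_eq_zero_left (hzero z)]
    have := hqneg.ne
    field_simp
  · refine le_of_forall_gt_imp_ge_of_dense fun t ht => ?_
    have h := hφS (w, t) ⟨v, r, hv, ht⟩
    rw [hφ] at h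
    have h' : ⟪w, p⟫ + t * q ≤ -s * q := by linarith
    have hmul : (t + s - ⟪w, (-q⁻¹) • p⟫) * q = ⟪w, p⟫ + (t + s) * q := by
      have := hqneg.ne
      rw [inner_smul_right]; field_simp; ring
    have : 0 ≤ t + s - ⟪w, (-q⁻¹) • p⟫ := by
      by_contra! hneg
      have := mul_pos_of_neg_of_neg hneg hqneg
      linarith
    linarith

theorem proxComp_adjoint_le (L : H →L[ℝ] G) (g : G → EReal) {γ : ℝ} (hγ : 0 < γ) {y : G}
    (hy : fconj (fconj g) y ≠ ⊥) :
    proxComp L γ g (ContinuousLinearMap.adjoint L y) ≤ fconj (fconj g) y +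
      (((qk y - qk (ContinuousLinearMap.adjoint L y)) / γ : ℝ) : EReal) := by
  generalize hb : fconj (fconj g) y = b at hy
  induction b with
  | bot => exact absurd rfl hy
  | top => simp
  | coe b =>
    have hb' := (fconj_le_coe_iff _ _ _).1 hb.le
    have key : fconj (fun z => menv (1 / γ) (fconj g) (L z)) (ContinuousLinearMap.adjoint L y)
        ≤ ((b + qk y / γ : ℝ) : EReal) := by
      rw [fconj_menv_comp_le_coe_iff]
      intro z v r hr
      have h1 : ⟪v, y⟫ - b ≤ r := by exact_mod_cast (hb' v).trans hr
      have h2 : 0 ≤ γ / 2 * ‖(L z - v) - γ⁻¹ • y‖ ^ 2 := by positivity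
      rw [norm_sub_sq_real, inner_smul_right, inner_sub_left, norm_smul, mul_pow,
        Real.norm_eq_abs, sq_abs] at h2
      rw [ContinuousLinearMap.adjoint_inner_right, qk]
      have h3 : γ / 2 * (‖L z - v‖ ^ 2 - 2 * (γ⁻¹ * (⟪L z, y⟫ - ⟪v, y⟫)) + γ⁻¹ ^ 2 * ‖y‖ ^ 2)
          = γ / 2 * ‖L z - v‖ ^ 2 - (⟪L z, y⟫ - ⟪v, y⟫) + ‖y‖ ^ 2 / 2 / γ := by
        field_simp
      linarith
    refine (EReal.sub_le_sub key le_rfl).trans (le_of_eq ?_)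
    norm_cast
    ring

theorem exists_proxComp_ge (L : H →L[ℝ] G) (g : G → EReal) {γ : ℝ} (hγ : 0 < γ)
    {v₀ : G} {r₀ : ℝ} (hv₀ : fconj g v₀ ≤ r₀) {x : H} (hx : proxComp L γ g x ≠ ⊤) :
    ∃ y : G, ContinuousLinearMap.adjoint L y = x ∧ fconj (fconj g) y +
      (((qk y - qk (ContinuousLinearMap.adjoint L y)) / γ : ℝ) : EReal) ≤ proxComp L γ g x := by
  unfold proxComp at *
  generalize hb : fconj (fun z => menv (1 / γ) (fconj g) (L z)) x = b at hx
  induction b with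
  | bot =>
    have h := (fconj_menv_comp_le_coe_iff L (fconj g) γ
      (-(r₀ + γ / 2 * ‖L 0 - v₀‖ ^ 2) - 1) x).1 (hb.trans_le bot_le) 0 v₀ r₀ hv₀
    rw [inner_zero_left] at h
    linarith
  | top => exact absurd (EReal.top_sub_coe _) hx
  | coe s =>
    obtain ⟨y, rfl, hy⟩ := exists_adjoint_eq_of_le_menv L g hγ hv₀
      ((fconj_menv_comp_le_coe_iff L (fconj g) γ s x).1 hb.le)
    refine ⟨y, rfl, ?_⟩
    have key : fconj (fconj g) y ≤ ((s - qk y / γ : ℝ) : EReal) := by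
      rw [fconj_le_coe_iff]
      refine fun v => EReal.coe_le_of_forall_real_ge fun r hr => ?_
      have h := hy (v + γ⁻¹ • y) v r hr
      rw [add_sub_cancel_left, inner_add_left, real_inner_smul_left,
        real_inner_self_eq_norm_sq, norm_smul, mul_pow, Real.norm_eq_abs, sq_abs] at h
      have h3 : γ⁻¹ * ‖y‖ ^ 2 - γ / 2 * (γ⁻¹ ^ 2 * ‖y‖ ^ 2) = ‖y‖ ^ 2 / 2 / γ := by
        field_simp; ring
      rw [qk]
      linarith
    refine (add_le_add_left key _).trans (le_of_eq ?_)
    norm_cast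
    ring

end Conjugation

/-- `(L ⊙_γ g)(x) = inf { g**(y) + Φ(y)/γ : L*y = x }`, the infimum being attained
whenever finite, and `dom (L ⊙_γ g) = L*(dom g**)`.  Here `Φ = Q_G − Q_H ∘ L*`. -/
theorem proxComp_eq_constrained_inf
    {H G : Type*} [NormedAddCommGroup H] [InnerProductSpace ℝ H] [CompleteSpace H]
    [NormedAddCommGroup G] [InnerProductSpace ℝ G] [CompleteSpace G]
    (L : H →L[ℝ] G) (g : G → EReal) (hg : ProperE g) (hm : HasAffMinorant g)
    (γ : ℝ) (hγ : 0 < γ) :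
    (∀ x : H, proxComp L γ g x =
        ⨅ y : {y : G // ContinuousLinearMap.adjoint L y = x},
          fconj (fconj g) (y : G) +
            (((qk (y : G) - qk (ContinuousLinearMap.adjoint L (y : G))) / γ : ℝ) : EReal)) ∧
    (∀ x : H, proxComp L γ g x ≠ ⊤ → proxComp L γ g x ≠ ⊥ →
        ∃ y : G, ContinuousLinearMap.adjoint L y = x ∧
          proxComp L γ g x =
            fconj (fconj g) y +
              (((qk y - qk (ContinuousLinearMap.adjoint L y)) / γ : ℝ) : EReal)) ∧
    {x : H | proxComp L γ g x ≠ ⊤} =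
      (ContinuousLinearMap.adjoint L) '' {y : G | fconj (fconj g) y ≠ ⊤} := by
  obtain ⟨u, c, hu⟩ := hm
  have hv₀ : fconj g u ≤ ((-c : ℝ) : EReal) := by
    rw [fconj_le_coe_iff]
    simpa using hu
  have hbot (y : G) : fconj (fconj g) y ≠ ⊥ := by
    intro h
    have h' := ((fconj_le_coe_iff (fconj g) y (⟪u, y⟫ + c - 1)).1 (h.trans_le bot_le) u).trans hv₀
    have : ⟪u, y⟫ - (⟪u, y⟫ + c - 1) ≤ -c := by exact_mod_cast h'
    linarith
  refine ⟨fun x => le_antisymm ?_ ?_, fun x hx _ => ?_, Set.ext fun x => ⟨fun hx => ?_, ?_⟩⟩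
  · refine le_iInf ?_
    rintro ⟨y, rfl⟩
    exact proxComp_adjoint_le L g hγ (hbot y)
  · by_cases hx : proxComp L γ g x = ⊤
    · exact hx ▸ le_top
    · obtain ⟨y, hy, hle⟩ := exists_proxComp_ge L g hγ hv₀ hx
      exact iInf_le_of_le ⟨y, hy⟩ hle
  · obtain ⟨y, rfl, hle⟩ := exists_proxComp_ge L g hγ hv₀ hx
    exact ⟨y, rfl, (proxComp_adjoint_le L g hγ (hbot y)).antisymm hle⟩
  · obtain ⟨y, hy, hle⟩ := exists_proxComp_ge L g hγ hv₀ hx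
    refine ⟨y, fun htop => hx (top_le_iff.1 ?_), hy⟩
    simpa [htop] using hle
  · rintro ⟨y, hy, rfl⟩
    exact ((proxComp_adjoint_le L g hγ (hbot y)).trans_lt
      (EReal.add_lt_top hy (EReal.coe_ne_top _))).ne
end

section
/- Let L ∈ B(H,G), let g : G → (−∞,+∞] be proper with a continuous affine minorant, and let γ > 0. Then for every x ∈ H, (L ⊚_γ g)(x) ≥ (env_γ(g**))(Lx), i.e. the proximal cocomposition dominates the Moreau envelope of the biconjugate composed with L. -/
open scoped RealInnerProductSpace
open Filter Set

section FenchelConjugate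

variable {H : Type*} [NormedAddCommGroup H] [InnerProductSpace ℝ H]

/-- A continuous affine minorant with slope `u` bounds the conjugate at `u` from above. -/
lemma fconj_le_of_affine_le {f : H → EReal} {u : H} {c : ℝ}
    (h : ∀ x, ((⟪x, u⟫ + c : ℝ) : EReal) ≤ f x) : fconj f u ≤ ((-c : ℝ) : EReal) := by
  refine iSup_le fun x => ?_
  have hx := EReal.sub_le_sub (le_refl ((⟪x, u⟫ : ℝ) : EReal)) (h x)
  refine hx.trans ?_
  rw [← EReal.coe_sub, EReal.coe_le_coe_iff]
  linarith

/-- The Fenchel–Young inequality, with the value of `f` bounded by a real number. -/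
lemma inner_sub_le_fconj {f : H → EReal} {x : H} {c : ℝ} (h : f x ≤ (c : EReal)) (u : H) :
    ((⟪x, u⟫ - c : ℝ) : EReal) ≤ fconj f u := by
  refine le_trans ?_ (le_iSup (fun x : H => ((⟪x, u⟫ : ℝ) : EReal) - f x) x)
  rw [EReal.coe_sub]
  exact EReal.sub_le_sub le_rfl h

lemma affine_le_fconj_fconj {f : H → EReal} {u : H} {c : ℝ}
    (h : ∀ x, ((⟪x, u⟫ + c : ℝ) : EReal) ≤ f x) (x : H) :
    ((⟪x, u⟫ + c : ℝ) : EReal) ≤ fconj (fconj f) x := by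
  have := inner_sub_le_fconj (fconj_le_of_affine_le h) x
  rwa [sub_neg_eq_add, real_inner_comm] at this

lemma fconj_fconj_le_coe {f : H → EReal} {x : H} {c : ℝ} (h : f x ≤ (c : EReal)) :
    fconj (fconj f) x ≤ (c : EReal) := by
  have := fconj_le_of_affine_le (f := fconj f) (u := x) (c := -c) fun u => by
    simpa [real_inner_comm, sub_eq_add_neg] using inner_sub_le_fconj h u
  simpa using this

lemma fconj_convex_combination_le (f : H → EReal) {x y : H} {r s a b : ℝ}
    (ha : 0 ≤ a) (hb : 0 ≤ b) (hab : a + b = 1)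
    (hx : fconj f x ≤ (r : EReal)) (hy : fconj f y ≤ (s : EReal)) :
    fconj f (a • x + b • y) ≤ ((a * r + b * s : ℝ) : EReal) := by
  refine iSup_le fun z => ?_
  have h₁ := (le_iSup (fun z : H => ((⟪z, x⟫ : ℝ) : EReal) - f z) z).trans hx
  have h₂ := (le_iSup (fun z : H => ((⟪z, y⟫ : ℝ) : EReal) - f z) z).trans hy
  induction hz : f z with
  | bot => simp [hz] at h₁
  | top => simp
  | coe t =>
    rw [hz, ← EReal.coe_sub, EReal.coe_le_coe_iff] at h₁ h₂
    rw [← EReal.coe_sub, EReal.coe_le_coe_iff, inner_add_right, real_inner_smul_right,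
      real_inner_smul_right]
    linear_combination a * h₁ + b * h₂ + t * hab

end FenchelConjugate

section MoreauEnvelope

variable {H : Type*} [NormedAddCommGroup H]

lemma menv_le_of_le {f : H → EReal} {y : H} {c : ℝ} (h : f y ≤ (c : EReal)) (γ : ℝ) (x : H) :
    menv γ f x ≤ ((c + ‖x - y‖ ^ 2 / (2 * γ) : ℝ) : EReal) := by
  refine (iInf_le _ y).trans ?_
  rw [EReal.coe_add]
  gcongr

lemma exists_le_of_menv_lt {γ : ℝ} {f : H → EReal} {x : H} {r : ℝ}
    (h : menv γ f x < (r : EReal)) :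
    ∃ y, f y ≤ ((r - ‖x - y‖ ^ 2 / (2 * γ) : ℝ) : EReal) := by
  obtain ⟨y, hy⟩ := iInf_lt_iff.1 h
  refine ⟨y, ?_⟩
  rw [EReal.coe_sub]
  exact EReal.le_sub_iff_add_le (by simp) (by simp) |>.2 hy.le

lemma menv_convex_combination_le [InnerProductSpace ℝ H] {γ : ℝ} (hγ : 0 < γ) {f : H → EReal}
    (hf : ∀ ⦃x y : H⦄ ⦃r s a b : ℝ⦄, 0 ≤ a → 0 ≤ b → a + b = 1 → f x ≤ (r : EReal) →
      f y ≤ (s : EReal) → f (a • x + b • y) ≤ ((a * r + b * s : ℝ) : EReal))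
    {x y : H} {r s a b : ℝ} (ha : 0 ≤ a) (hb : 0 ≤ b) (hab : a + b = 1)
    (hx : menv γ f x < (r : EReal)) (hy : menv γ f y < (s : EReal)) :
    menv γ f (a • x + b • y) ≤ ((a * r + b * s : ℝ) : EReal) := by
  obtain ⟨p, hp⟩ := exists_le_of_menv_lt hx
  obtain ⟨q, hq⟩ := exists_le_of_menv_lt hy
  refine (menv_le_of_le (hf ha hb hab hp hq) γ _).trans ?_
  rw [EReal.coe_le_coe_iff]
  have hsq : ‖a • x + b • y - (a • p + b • q)‖ ^ 2 ≤ a * ‖x - p‖ ^ 2 + b * ‖y - q‖ ^ 2 := by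
    have hn : a • x + b • y - (a • p + b • q) = a • (x - p) + b • (y - q) := by module
    have h := ((convexOn_norm (convex_univ (𝕜 := ℝ) (E := H))).pow
      (fun _ _ => norm_nonneg _) 2).2 (mem_univ (x - p)) (mem_univ (y - q)) ha hb hab
    rw [hn]
    simpa using h
  have := div_le_div_of_nonneg_right hsq (by positivity : 0 ≤ 2 * γ)
  rw [add_div, mul_div_assoc, mul_div_assoc] at this
  linarith

lemma exists_coe_le_menv_of_affine_le [InnerProductSpace ℝ H] {γ : ℝ} (hγ : 0 < γ)
    {f : H → EReal} (hf : HasAffMinorant f) (x : H) : ∃ m : ℝ, (m : EReal) ≤ menv γ f x := by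
  obtain ⟨u, c, h⟩ := hf
  refine ⟨⟪x, u⟫ + c - γ * ‖u‖ ^ 2 / 2, le_iInf fun y => ?_⟩
  refine le_trans ?_ (add_le_add_left (h y) _)
  rw [← EReal.coe_add, EReal.coe_le_coe_iff]
  have hin : ⟪x, u⟫ - ⟪y, u⟫ ≤ ‖x - y‖ * ‖u‖ := by
    rw [← inner_sub_left]
    exact real_inner_le_norm _ _
  have hsq : ‖x - y‖ * ‖u‖ ≤ ‖x - y‖ ^ 2 / (2 * γ) + γ * ‖u‖ ^ 2 / 2 := by
    have h0 : 0 ≤ (‖x - y‖ - γ * ‖u‖) ^ 2 / (2 * γ) := by positivity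
    have h1 : (‖x - y‖ - γ * ‖u‖) ^ 2 / (2 * γ)
        = ‖x - y‖ ^ 2 / (2 * γ) + γ * ‖u‖ ^ 2 / 2 - ‖x - y‖ * ‖u‖ := by
      field_simp
      ring
    linarith
  linarith

end MoreauEnvelope

/-- The Moreau envelope of the biconjugate of a proper function with a continuous affine minorant
is a real-valued continuous convex function. -/
lemma exists_menv_fconj_fconj_eq_coe {G : Type*} [NormedAddCommGroup G] [InnerProductSpace ℝ G]
    {g : G → EReal} (hg : ProperE g) (hm : HasAffMinorant g) {γ : ℝ} (hγ : 0 < γ) :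
    ∃ φ : G → ℝ, (∀ y, menv γ (fconj (fconj g)) y = (φ y : EReal)) ∧
      ConvexOn ℝ univ φ ∧ Continuous φ := by
  obtain ⟨⟨x₀, hx₀⟩, hbot⟩ := hg
  have hle : fconj (fconj g) x₀ ≤ ((g x₀).toReal : EReal) :=
    fconj_fconj_le_coe (EReal.coe_toReal hx₀ (hbot x₀)).ge
  have hub := menv_le_of_le hle γ
  have hm' : HasAffMinorant (fconj (fconj g)) := by
    obtain ⟨u, c, h⟩ := hm
    exact ⟨u, c, affine_le_fconj_fconj h⟩
  have hφ (y : G) :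
      menv γ (fconj (fconj g)) y = ((menv γ (fconj (fconj g)) y).toReal : EReal) := by
    obtain ⟨m, hlb⟩ := exists_coe_le_menv_of_affine_le hγ hm' y
    exact (EReal.coe_toReal ((hub y).trans_lt (EReal.coe_lt_top _)).ne
      ((EReal.bot_lt_coe _).trans_le hlb).ne').symm
  generalize hdef : (fun y => (menv γ (fconj (fconj g)) y).toReal) = φ at *
  replace hφ (y : G) : menv γ (fconj (fconj g)) y = (φ y : EReal) := by
    rw [← hdef]
    exact hφ y
  have hconv : ConvexOn ℝ univ φ := by
    refine ⟨convex_univ, fun x _ y _ a b ha hb hab => ?_⟩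
    refine le_of_forall_pos_le_add fun ε hε => ?_
    have h := menv_convex_combination_le (f := fconj (fconj g)) hγ
      (fun _ _ _ _ _ _ ha hb hab => fconj_convex_combination_le _ ha hb hab)
      (x := x) (y := y) (r := φ x + ε) (s := φ y + ε) ha hb hab
      (by rw [hφ, EReal.coe_lt_coe_iff]; linarith) (by rw [hφ, EReal.coe_lt_coe_iff]; linarith)
    rw [hφ, EReal.coe_le_coe_iff] at h
    simp only [smul_eq_mul]
    linear_combination h + ε * hab
  refine ⟨φ, hφ, hconv, ?_⟩
  rw [← continuousOn_univ]
  refine ((hconv.continuousOn_tfae isOpen_univ univ_nonempty).out 3 1 :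
    (∃ x ∈ univ, IsBoundedUnder (· ≤ ·) (nhds x) φ) ↔ ContinuousOn φ univ).1 ⟨x₀, mem_univ _, ?_⟩
  have hcont : ContinuousAt (fun y => (g x₀).toReal + ‖y - x₀‖ ^ 2 / (2 * γ)) x₀ := by fun_prop
  refine hcont.isBoundedUnder_le.mono_le (.of_forall fun y => ?_)
  have := hub y
  rwa [hφ, EReal.coe_le_coe_iff] at this

lemma affine_le_proxCocomp {H G : Type*} [NormedAddCommGroup H] [InnerProductSpace ℝ H]
    [NormedAddCommGroup G] [InnerProductSpace ℝ G] {L : H →L[ℝ] G} {g : G → EReal} {γ : ℝ}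
    (hγ : 0 ≤ γ) {u : H} {c : ℝ}
    (h : ∀ z, ((⟪z, u⟫ + c : ℝ) : EReal) ≤ menv γ (fconj (fconj g)) (L z)) (x : H) :
    ((⟪x, u⟫ + c : ℝ) : EReal) ≤ proxCocomp L γ g x := by
  have hu : proxComp L (1 / γ) (fconj g) u ≤ ((-c : ℝ) : EReal) := by
    unfold proxComp
    rw [one_div_one_div]
    refine (EReal.sub_le_sub (fconj_le_of_affine_le h) le_rfl).trans ?_
    rw [← EReal.coe_sub, EReal.coe_le_coe_iff]
    have : 0 ≤ γ * qk u := by unfold qk; positivity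
    linarith
  have := inner_sub_le_fconj hu x
  rwa [sub_neg_eq_add, real_inner_comm] at this

/-- `L ⊚_γ g ≥ env_γ(g**) ∘ L`. -/
theorem proxCocomp_ge_env_biconj
    {H G : Type*} [NormedAddCommGroup H] [InnerProductSpace ℝ H] [CompleteSpace H]
    [NormedAddCommGroup G] [InnerProductSpace ℝ G] [CompleteSpace G]
    (L : H →L[ℝ] G) (g : G → EReal) (hg : ProperE g) (hm : HasAffMinorant g)
    (γ : ℝ) (hγ : 0 < γ) :
    ∀ x : H, menv γ (fconj (fconj g)) (L x) ≤ proxCocomp L γ g x := by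
  intro x
  obtain ⟨φ, hφ, hconv, hcont⟩ := exists_menv_fconj_fconj_eq_coe hg hm hγ
  have hconvL : ConvexOn ℝ univ (φ ∘ L) := hconv.comp_linearMap L.toLinearMap
  have hcontL : Continuous (φ ∘ L) := hcont.comp L.continuous
  rw [hφ]
  refine EReal.ge_of_forall_gt_iff_ge.1 fun a ha => ?_
  obtain ⟨l, c, hl, hlx⟩ := hconvL.exists_affine_le_of_lt (𝕜 := ℝ) (mem_univ x)
    (EReal.coe_lt_coe_iff.1 ha) isClosed_univ (hcontL.lowerSemicontinuous.lowerSemicontinuousOn univ)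
  have hinner (z : H) : ⟪z, (InnerProductSpace.toDual ℝ H).symm l⟫ = l z := by
    rw [real_inner_comm, InnerProductSpace.toDual_symm_apply]
  have h := affine_le_proxCocomp (L := L) (g := g) hγ.le
    (u := (InnerProductSpace.toDual ℝ H).symm l) (c := c) (fun z => by
      rw [hφ, hinner, EReal.coe_le_coe_iff]
      simpa using hl ⟨z, mem_univ z⟩) x
  rw [hinner] at h
  rw [← hlx]
  simpa using h
end

section
/- Let L ∈ B(H,G) satisfy 0 < ‖L‖ < 1, let g : G → (−∞,+∞] be proper with a continuous affine minorant, let γ > 0, and set β = γ(1/‖L‖² − 1). Then L ⊚_γ g is a real-valued convex function on H that is Fréchet differentiable with a (1/β)-Lipschitzian gradient. -/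
open scoped RealInnerProductSpace
open Filter Set

section SmoothConvex

variable {H : Type*} [NormedAddCommGroup H] [InnerProductSpace ℝ H]

/-- A function with approximate subgradients everywhere that satisfies the midpoint inequality of
`(1 / β)`-smooth functions has exact subgradients everywhere. -/
theorem exists_subgradient_of_approx [CompleteSpace H] {β : ℝ} (hβ : 0 < β) {F : H → ℝ}
    (hsub : ∀ x, ∀ ε > 0, ∃ u : H, ∀ y, F x - ε + ⟪u, y - x⟫ ≤ F y)
    (hmid : ∀ x h, F (x + h) + F (x - h) ≤ 2 * F x + ‖h‖ ^ 2 / β) (x : H) :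
    ∃ u : H, ∀ y, F x + ⟪u, y - x⟫ ≤ F y := by
  have hpos : ∀ n : ℕ, (0 : ℝ) < (1 / 2) ^ n := fun n => by positivity
  choose u hu using fun n : ℕ => hsub x ((1 / 2) ^ n) (hpos n)
  have hdist : ∀ m n, β / 4 * ‖u m - u n‖ ^ 2 ≤ (1 / 2) ^ m + (1 / 2) ^ n := by
    intro m n
    have h1 := hu m (x + (β / 2) • (u m - u n))
    have h2 := hu n (x - (β / 2) • (u m - u n))
    have h3 := hmid x ((β / 2) • (u m - u n))
    have e1 : ⟪u m, x + (β / 2) • (u m - u n) - x⟫ + ⟪u n, x - (β / 2) • (u m - u n) - x⟫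
        = β / 2 * ‖u m - u n‖ ^ 2 := by
      rw [add_sub_cancel_left, sub_sub_cancel_left, inner_neg_right, inner_smul_right,
        inner_smul_right, ← real_inner_self_eq_norm_sq, inner_sub_left]
      ring
    have e2 : ‖(β / 2) • (u m - u n)‖ ^ 2 / β = β / 4 * ‖u m - u n‖ ^ 2 := by
      rw [norm_smul, mul_pow, Real.norm_eq_abs, sq_abs]
      field_simp
      ring
    linarith
  have hcauchy : CauchySeq u := by
    rw [Metric.cauchySeq_iff']
    intro ε hε
    obtain ⟨N, hN⟩ := exists_pow_lt_of_lt_one (show 0 < β / 8 * ε ^ 2 by positivity)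
      (show (1 / 2 : ℝ) < 1 by norm_num)
    refine ⟨N, fun n hn => ?_⟩
    have h1 := hdist n N
    have h2 : ((1 : ℝ) / 2) ^ n ≤ (1 / 2) ^ N :=
      pow_le_pow_of_le_one (by norm_num) (by norm_num) hn
    rw [dist_eq_norm]
    refine lt_of_pow_lt_pow_left₀ 2 hε.le ?_
    refine lt_of_mul_lt_mul_left (a := β / 4) ?_ (by positivity)
    linarith
  obtain ⟨v, hv⟩ := cauchySeq_tendsto_of_complete hcauchy
  refine ⟨v, fun y => ?_⟩
  have hpow : Tendsto (fun n : ℕ => ((1 : ℝ) / 2) ^ n) atTop (nhds 0) :=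
    tendsto_pow_atTop_nhds_zero_of_lt_one (by norm_num) (by norm_num)
  have hlim : Tendsto (fun n : ℕ => F x - (1 / 2) ^ n + ⟪u n, y - x⟫) atTop
      (nhds (F x - 0 + ⟪v, y - x⟫)) :=
    (tendsto_const_nhds.sub hpow).add (hv.inner tendsto_const_nhds)
  rw [sub_zero] at hlim
  exact le_of_tendsto' hlim fun n => hu n y

/-- The descent inequality for a `(1 / β)`-semiconcave function at a point with a subgradient. -/
theorem descent_of_subgradient {β : ℝ} (hβ : 0 < β) {F : H → ℝ} {x p : H}
    (hp : ∀ y, F x + ⟪p, y - x⟫ ≤ F y)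
    (hsemi : ∀ x y : H, ∀ t : ℝ, 0 < t → t < 1 →
      (1 - t) * F x + t * F y - t * (1 - t) / (2 * β) * ‖x - y‖ ^ 2
        ≤ F ((1 - t) • x + t • y))
    (hmid : ∀ x h, F (x + h) + F (x - h) ≤ 2 * F x + ‖h‖ ^ 2 / β) (y : H) :
    F y ≤ F x + ⟪p, y - x⟫ + ‖y - x‖ ^ 2 / (2 * β) := by
  refine le_of_forall_pos_le_add fun ε hε => ?_
  set D := ‖y - x‖ ^ 2 / (2 * β) with hD
  have hD0 : 0 ≤ D := by positivity
  set t : ℝ := ε / (ε + D + 1) with ht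
  have ht0 : 0 < t := by positivity
  have ht1 : t < 1 := by rw [ht, div_lt_one (by positivity)]; linarith
  have htD : t * D ≤ ε := by
    rw [ht, div_mul_eq_mul_div, div_le_iff₀ (by positivity)]
    nlinarith
  have h1 := hsemi x y t ht0 ht1
  have h2 := hmid x (t • (y - x))
  have h3 := hp (x - t • (y - x))
  have e1 : (1 - t) • x + t • y = x + t • (y - x) := by
    rw [smul_sub, sub_smul, one_smul]; abel
  rw [e1, norm_sub_rev] at h1
  rw [sub_sub_cancel_left, inner_neg_right, inner_smul_right] at h3
  have e2 : t * (1 - t) / (2 * β) * ‖y - x‖ ^ 2 = t * ((1 - t) * D) := by rw [hD]; ring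
  have e3 : ‖t • (y - x)‖ ^ 2 / β = t * (2 * t * D) := by
    rw [norm_smul, mul_pow, Real.norm_eq_abs, sq_abs, hD]; field_simp
  rw [e2] at h1
  rw [e3] at h2
  have h4 : t * F y ≤ t * (F x + ⟪p, y - x⟫ + (1 - t) * D + 2 * t * D) := by linarith
  have h5 := le_of_mul_le_mul_left h4 ht0
  linarith

/-- The Baillon–Haddad inequality yields Lipschitz continuity of the subgradient selection. -/
theorem lipschitzWith_of_subgradient_of_descent {β : ℝ} (hβ : 0 < β) {F : H → ℝ} {F' : H → H}
    (hsub : ∀ x y, F x + ⟪F' x, y - x⟫ ≤ F y)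
    (hdesc : ∀ x y, F y ≤ F x + ⟪F' x, y - x⟫ + ‖y - x‖ ^ 2 / (2 * β)) :
    LipschitzWith (Real.toNNReal (1 / β)) F' := by
  have key : ∀ x y, F y + ⟪F' y, x - y⟫ + β / 2 * ‖F' y - F' x‖ ^ 2 ≤ F x := by
    intro x y
    have h1 := hsub y (x + β • (F' y - F' x))
    have h2 := hdesc x (x + β • (F' y - F' x))
    have e1 : x + β • (F' y - F' x) - y = (x - y) + β • (F' y - F' x) := by abel
    have e2 : ‖β • (F' y - F' x)‖ ^ 2 / (2 * β) = β / 2 * ‖F' y - F' x‖ ^ 2 := by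
      rw [norm_smul, mul_pow, Real.norm_eq_abs, sq_abs]; field_simp
    have e3 : ⟪F' y, F' y - F' x⟫ - ⟪F' x, F' y - F' x⟫ = ‖F' y - F' x‖ ^ 2 := by
      rw [← inner_sub_left, real_inner_self_eq_norm_sq]
    rw [e1, inner_add_right, inner_smul_right] at h1
    rw [add_sub_cancel_left, inner_smul_right, e2] at h2
    linear_combination h1 + h2 - β * e3
  refine LipschitzWith.of_dist_le_mul fun x y => ?_
  rw [Real.coe_toNNReal _ (by positivity), dist_eq_norm, dist_eq_norm]
  have h1 := key x y
  have h2 := key y x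
  have h3 := real_inner_le_norm (F' x - F' y) (x - y)
  have e1 : ⟪F' x - F' y, x - y⟫ = -⟪F' x, y - x⟫ - ⟪F' y, x - y⟫ := by
    rw [inner_sub_left, ← inner_neg_right, neg_sub]
  rw [norm_sub_rev (F' y)] at h1
  rw [div_mul_eq_mul_div, one_mul, le_div_iff₀ hβ]
  rcases (norm_nonneg (F' x - F' y)).eq_or_lt with h0 | h0
  · rw [← h0, zero_mul]; exact norm_nonneg _
  · refine le_of_mul_le_mul_left ?_ h0
    linear_combination h1 + h2 + h3 - e1

/-- A function with approximate subgradients everywhere that is `(1 / β)`-semiconcave is convex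
and differentiable with a `(1 / β)`-Lipschitz gradient. -/
theorem convex_and_lipschitz_gradient_of_semiconcave [CompleteSpace H] {β : ℝ} (hβ : 0 < β)
    {F : H → ℝ} (hsub : ∀ x, ∀ ε > 0, ∃ u : H, ∀ y, F x - ε + ⟪u, y - x⟫ ≤ F y)
    (hsemi : ∀ x y : H, ∀ t : ℝ, 0 < t → t < 1 →
      (1 - t) * F x + t * F y - t * (1 - t) / (2 * β) * ‖x - y‖ ^ 2
        ≤ F ((1 - t) • x + t • y)) :
    ConvexOn ℝ Set.univ F ∧ ∃ F' : H → H, (∀ x : H, HasGradientAt F (F' x) x) ∧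
      LipschitzWith (Real.toNNReal (1 / β)) F' := by
  have hmid : ∀ x h, F (x + h) + F (x - h) ≤ 2 * F x + ‖h‖ ^ 2 / β := by
    intro x h
    have h1 := hsemi (x + h) (x - h) (1 / 2) (by norm_num) (by norm_num)
    have e1 : (1 - 1 / 2 : ℝ) • (x + h) + (1 / 2 : ℝ) • (x - h) = x := by module
    have e2 : x + h - (x - h) = (2 : ℝ) • h := by module
    have e3 : (1 / 2 : ℝ) * (1 - 1 / 2) / (2 * β) * ‖(2 : ℝ) • h‖ ^ 2 = ‖h‖ ^ 2 / β / 2 := by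
      rw [norm_smul, mul_pow, Real.norm_eq_abs, sq_abs]; field_simp; norm_num
    rw [e1, e2, e3] at h1
    linarith
  choose F' hF' using exists_subgradient_of_approx hβ hsub hmid
  have hdesc := fun x => descent_of_subgradient hβ (hF' x) hsemi hmid
  refine ⟨⟨convex_univ, fun x _ y _ a b ha hb hab => ?_⟩, F', fun x => ?_,
    lipschitzWith_of_subgradient_of_descent hβ hF' hdesc⟩
  · have h1 := mul_le_mul_of_nonneg_left (hF' (a • x + b • y) x) ha
    have h2 := mul_le_mul_of_nonneg_left (hF' (a • x + b • y) y) hb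
    have e : a * ⟪F' (a • x + b • y), x - (a • x + b • y)⟫
        + b * ⟪F' (a • x + b • y), y - (a • x + b • y)⟫ = 0 := by
      rw [← inner_smul_right, ← inner_smul_right, ← inner_add_right]
      have : a • (x - (a • x + b • y)) + b • (y - (a • x + b • y)) = 0 := by
        obtain rfl : b = 1 - a := by linarith
        module
      rw [this, inner_zero_right]
    simp only [smul_eq_mul]
    linear_combination h1 + h2 - e - F (a • x + b • y) * hab
  · rw [hasGradientAt_iff_isLittleO]
    refine Asymptotics.IsBigO.trans_isLittleO (g := fun y => ‖y - x‖ ^ 2) ?_ ?_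
    · refine Asymptotics.IsBigO.of_bound (1 / (2 * β)) (Eventually.of_forall fun y => ?_)
      have h1 := hF' x y
      have h2 := hdesc x y
      rw [Real.norm_eq_abs, abs_of_nonneg (by linarith), norm_pow, norm_norm,
        div_mul_eq_mul_div, one_mul]
      linarith
    · exact Asymptotics.isLittleO_pow_sub_sub x one_lt_two

end SmoothConvex

section ConjugateReal

variable {H : Type*} [NormedAddCommGroup H] [InnerProductSpace ℝ H]

/-- The epigraph of the Fenchel conjugate of a real-valued function. -/
def conjEpi (φ : H → ℝ) : Set (H × ℝ) := {p | ∀ z, ⟪z, p.1⟫ - φ z ≤ p.2}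

/-- The conjugate of `φ* - γ Q` for real-valued `φ`, as a real supremum over the epigraph
of `φ*`. -/
noncomputable def conjSubQuad (φ : H → ℝ) (γ : ℝ) (y : H) : ℝ :=
  sSup ((fun p : H × ℝ => ⟪p.1, y⟫ - (p.2 - γ * qk p.1)) '' conjEpi φ)

/-- The conjugate of a `(1 / s)`-semiconcave function is `s`-strongly convex. -/
theorem conjEpi_strongly_convex {φ : H → ℝ} {s : ℝ} (hs : 0 < s)
    (hφ : ∀ x y : H, ∀ t : ℝ, 0 < t → t < 1 →
      (1 - t) * φ x + t * φ y - t * (1 - t) / (2 * s) * ‖x - y‖ ^ 2 ≤ φ ((1 - t) • x + t • y))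
    {u v : H} {a b t : ℝ} (hu : (u, a) ∈ conjEpi φ) (hv : (v, b) ∈ conjEpi φ)
    (ht0 : 0 < t) (ht1 : t < 1) :
    ((1 - t) • u + t • v, (1 - t) * a + t * b - t * (1 - t) * s / 2 * ‖u - v‖ ^ 2)
      ∈ conjEpi φ := by
  intro z
  have h1 := mul_le_mul_of_nonneg_left (hu (z + (t * s) • (u - v))) (sub_nonneg.2 ht1.le)
  have h2 := mul_le_mul_of_nonneg_left (hv (z - ((1 - t) * s) • (u - v))) ht0.le
  have h3 := hφ (z + (t * s) • (u - v)) (z - ((1 - t) * s) • (u - v)) t ht0 ht1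
  have e1 : (1 - t) • (z + (t * s) • (u - v)) + t • (z - ((1 - t) * s) • (u - v)) = z := by
    module
  have e2 : z + (t * s) • (u - v) - (z - ((1 - t) * s) • (u - v)) = s • (u - v) := by module
  have e3 : t * (1 - t) / (2 * s) * ‖s • (u - v)‖ ^ 2 = t * (1 - t) * s / 2 * ‖u - v‖ ^ 2 := by
    rw [norm_smul, mul_pow, Real.norm_eq_abs, sq_abs]; field_simp
  have e4 : ⟪u - v, u⟫ - ⟪u - v, v⟫ = ‖u - v‖ ^ 2 := by
    rw [← inner_sub_right, real_inner_self_eq_norm_sq]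
  rw [e1, e2, e3] at h3
  simp only [inner_add_left, inner_sub_left z, inner_smul_left, RCLike.conj_to_real] at h1 h2
  simp only [inner_add_right, inner_smul_right]
  linear_combination h1 + h2 + h3 - t * (1 - t) * s * e4

theorem conjSubQuad_bddAbove {φ : H → ℝ} {γ β : ℝ} (hγ : 0 < γ) (hβ : 0 < β) {q : H} {M : ℝ}
    (hφ : ∀ z, φ z ≤ ‖z‖ ^ 2 / (2 * (γ + β)) + ⟪z, q⟫ + M) (y : H) :
    BddAbove ((fun p : H × ℝ => ⟪p.1, y⟫ - (p.2 - γ * qk p.1)) '' conjEpi φ) := by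
  have hs : 0 < γ + β := by positivity
  refine ⟨M + ‖y + (γ + β) • q‖ ^ 2 / (2 * β), ?_⟩
  rintro _ ⟨⟨x, a⟩, hx, rfl⟩
  have h1 := hx ((γ + β) • x)
  have h2 := hφ ((γ + β) • x)
  have e1 : ‖(γ + β) • x‖ ^ 2 / (2 * (γ + β)) = (γ + β) / 2 * ‖x‖ ^ 2 := by
    rw [norm_smul, mul_pow, Real.norm_eq_abs, sq_abs]; field_simp
  have h3 : ⟪x, y + (γ + β) • q⟫ ≤ ‖y + (γ + β) • q‖ ^ 2 / (2 * β) + β / 2 * ‖x‖ ^ 2 := by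
    have h4 := real_inner_le_norm x (y + (γ + β) • q)
    have h5 : ‖y + (γ + β) • q‖ ^ 2 / (2 * β) + β / 2 * ‖x‖ ^ 2
        - ‖x‖ * ‖y + (γ + β) • q‖ = (‖y + (γ + β) • q‖ - β * ‖x‖) ^ 2 / (2 * β) := by
      field_simp; ring
    have h6 : 0 ≤ (‖y + (γ + β) • q‖ - β * ‖x‖) ^ 2 / (2 * β) := by positivity
    linarith
  rw [e1, real_inner_smul_left] at h2
  rw [inner_add_right, inner_smul_right] at h3
  simp only [real_inner_smul_left, real_inner_self_eq_norm_sq] at h1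
  simp only [qk]
  linarith

/-- If `φ` is `1 / (γ + β)`-semiconcave with suitable growth, then `(φ* - γ Q)*` is convex and
differentiable with a `(1 / β)`-Lipschitz gradient. -/
theorem conjSubQuad_convex_and_lipschitz_gradient [CompleteSpace H] {φ : H → ℝ} {γ β : ℝ}
    (hγ : 0 < γ) (hβ : 0 < β)
    (hsemi : ∀ x y : H, ∀ t : ℝ, 0 < t → t < 1 →
      (1 - t) * φ x + t * φ y - t * (1 - t) / (2 * (γ + β)) * ‖x - y‖ ^ 2
        ≤ φ ((1 - t) • x + t • y))
    (hne : (conjEpi φ).Nonempty) {q : H} {M : ℝ}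
    (hφ : ∀ z, φ z ≤ ‖z‖ ^ 2 / (2 * (γ + β)) + ⟪z, q⟫ + M) :
    ConvexOn ℝ Set.univ (conjSubQuad φ γ) ∧
      ∃ F' : H → H, (∀ x : H, HasGradientAt (conjSubQuad φ γ) (F' x) x) ∧
        LipschitzWith (Real.toNNReal (1 / β)) F' := by
  have hle : ∀ {u a} (y : H), (u, a) ∈ conjEpi φ →
      ⟪u, y⟫ - (a - γ * qk u) ≤ conjSubQuad φ γ y := fun y h =>
    le_csSup (conjSubQuad_bddAbove hγ hβ hφ y) ⟨_, h, rfl⟩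
  have hex : ∀ (y : H) (ε : ℝ), 0 < ε → ∃ u a, (u, a) ∈ conjEpi φ ∧
      conjSubQuad φ γ y - ε < ⟪u, y⟫ - (a - γ * qk u) := by
    intro y ε hε
    obtain ⟨_, ⟨⟨u, a⟩, h, rfl⟩, h'⟩ :=
      exists_lt_of_lt_csSup (hne.image _) (sub_lt_self (conjSubQuad φ γ y) hε)
    exact ⟨u, a, h, h'⟩
  refine convex_and_lipschitz_gradient_of_semiconcave hβ (fun x ε hε => ?_)
    (fun x y t ht0 ht1 => ?_)
  · obtain ⟨u, a, h, h'⟩ := hex x ε hε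
    refine ⟨u, fun y => ?_⟩
    have := hle y h
    rw [inner_sub_right]
    linarith
  · refine le_of_forall_pos_le_add fun ε hε => ?_
    obtain ⟨u, a, hu, hu'⟩ := hex x ε hε
    obtain ⟨v, b, hv, hv'⟩ := hex y ε hε
    have h1 := hle ((1 - t) • x + t • y)
      (conjEpi_strongly_convex (by positivity) hsemi hu hv ht0 ht1)
    have hu1 := mul_le_mul_of_nonneg_left hu'.le (sub_nonneg.2 ht1.le)
    have hv1 := mul_le_mul_of_nonneg_left hv'.le ht0.le
    have e1 : ‖(1 - t) • u + t • v‖ ^ 2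
        = (1 - t) * ‖u‖ ^ 2 + t * ‖v‖ ^ 2 - t * (1 - t) * ‖u - v‖ ^ 2 := by
      rw [norm_add_sq_real, norm_sub_sq_real, norm_smul, norm_smul, mul_pow, mul_pow,
        Real.norm_eq_abs, Real.norm_eq_abs, sq_abs, sq_abs, inner_smul_left, inner_smul_right,
        RCLike.conj_to_real]
      ring
    have h2 : ⟪u - v, x - y⟫ ≤ 1 / (2 * β) * ‖x - y‖ ^ 2 + β / 2 * ‖u - v‖ ^ 2 := by
      have h4 := real_inner_le_norm (u - v) (x - y)
      have h5 : 1 / (2 * β) * ‖x - y‖ ^ 2 + β / 2 * ‖u - v‖ ^ 2 - ‖u - v‖ * ‖x - y‖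
          = (‖x - y‖ - β * ‖u - v‖) ^ 2 / (2 * β) := by
        field_simp; ring
      have h6 : 0 ≤ (‖x - y‖ - β * ‖u - v‖) ^ 2 / (2 * β) := by positivity
      linarith
    have h3 := mul_le_mul_of_nonneg_left h2
      (mul_nonneg ht0.le (sub_nonneg.2 ht1.le))
    simp only [qk, e1] at h1 hu1 hv1
    simp only [inner_add_left, inner_add_right, inner_sub_left, inner_sub_right,
      inner_smul_left, inner_smul_right, RCLike.conj_to_real] at h1 h3
    linear_combination h1 + hu1 + hv1 + h3

/-- The extended-real conjugate of `φ* - γ Q` is the real-valued `conjSubQuad`. -/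
theorem fconj_fconj_sub_quad_eq {φ : H → ℝ} {γ β : ℝ} (hγ : 0 < γ) (hβ : 0 < β)
    (hne : (conjEpi φ).Nonempty) {q : H} {M : ℝ}
    (hφ : ∀ z, φ z ≤ ‖z‖ ^ 2 / (2 * (γ + β)) + ⟪z, q⟫ + M) (y : H) :
    fconj (fun x => fconj (fun z => (φ z : EReal)) x - ((γ * qk x : ℝ) : EReal)) y
      = (conjSubQuad φ γ y : EReal) := by
  have hcoe : ∀ x z : H, ((⟪z, x⟫ : ℝ) : EReal) - (φ z : EReal)
      ≤ fconj (fun z => (φ z : EReal)) x := fun x z =>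
    le_iSup (fun z : H => ((⟪z, x⟫ : ℝ) : EReal) - (φ z : EReal)) z
  apply le_antisymm
  · refine iSup_le fun x => ?_
    have hx := hcoe x
    beta_reduce
    induction hA : fconj (fun z => (φ z : EReal)) x with
    | bot =>
      have := hx 0
      rw [hA, ← EReal.coe_sub] at this
      exact absurd (le_bot_iff.1 this) (EReal.coe_ne_bot _)
    | top => rw [EReal.top_sub_coe, EReal.sub_top]; exact bot_le
    | coe a =>
      have hmem : (x, a) ∈ conjEpi φ := fun z => by
        have := hx z
        rw [hA] at this
        exact_mod_cast this
      have : ⟪x, y⟫ - (a - γ * qk x) ≤ conjSubQuad φ γ y :=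
        le_csSup (conjSubQuad_bddAbove hγ hβ hφ y) ⟨_, hmem, rfl⟩
      exact_mod_cast this
  · have hB : ∀ p ∈ conjEpi φ, ((⟪p.1, y⟫ - (p.2 - γ * qk p.1) : ℝ) : EReal) ≤
        fconj (fun x => fconj (fun z => (φ z : EReal)) x - ((γ * qk x : ℝ) : EReal)) y := by
      rintro ⟨x, a⟩ hx
      have h1 : fconj (fun z => (φ z : EReal)) x ≤ (a : EReal) :=
        iSup_le fun z => by
          have : ⟪z, x⟫ - φ z ≤ a := hx z
          beta_reduce
          exact_mod_cast this
      refine le_trans ?_ (le_iSup (fun x : H => ((⟪x, y⟫ : ℝ) : EReal) -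
        (fconj (fun z => (φ z : EReal)) x - ((γ * qk x : ℝ) : EReal))) x)
      rw [EReal.coe_sub, EReal.coe_sub]
      exact EReal.sub_le_sub le_rfl (EReal.sub_le_sub h1 le_rfl)
    generalize fconj (fun x => fconj (fun z => (φ z : EReal)) x - ((γ * qk x : ℝ) : EReal)) y
      = B at hB
    induction B with
    | bot =>
      obtain ⟨p, hp⟩ := hne
      exact absurd (le_bot_iff.1 (hB p hp)) (EReal.coe_ne_bot _)
    | top => exact le_top
    | coe b =>
      refine EReal.coe_le_coe_iff.2 (csSup_le (hne.image _) ?_)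
      rintro _ ⟨p, hp, rfl⟩
      exact_mod_cast hB p hp

end ConjugateReal

section Envelope

variable {H G : Type*} [NormedAddCommGroup H] [InnerProductSpace ℝ H]
  [NormedAddCommGroup G] [InnerProductSpace ℝ G]

theorem fconj_fconj_le (g : G → EReal) (w : G) : fconj (fconj g) w ≤ g w := by
  refine iSup_le fun u => ?_
  have h : ((⟪w, u⟫ : ℝ) : EReal) - g w ≤ fconj g u :=
    le_iSup (fun x : G => ((⟪x, u⟫ : ℝ) : EReal) - g x) w
  rw [real_inner_comm]
  induction hgw : g w with
  | bot =>
    rw [hgw, EReal.sub_bot (EReal.coe_ne_bot _), top_le_iff] at h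
    simp [h]
  | top => exact le_top
  | coe r =>
    rw [hgw] at h
    refine (EReal.sub_le_sub le_rfl h).trans ?_
    norm_cast
    simp

theorem le_fconj_fconj {g : G → EReal} {u : G} {c : ℝ}
    (h : ∀ x, ((⟪x, u⟫ + c : ℝ) : EReal) ≤ g x) (w : G) :
    ((⟪w, u⟫ + c : ℝ) : EReal) ≤ fconj (fconj g) w := by
  have h1 : fconj g u ≤ ((-c : ℝ) : EReal) := iSup_le fun x => by
    refine (EReal.sub_le_sub le_rfl (h x)).trans ?_
    norm_cast
    simp
  refine le_trans ?_ (le_iSup (fun v : G => ((⟪v, w⟫ : ℝ) : EReal) - fconj g v) u)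
  refine le_trans ?_ (EReal.sub_le_sub le_rfl h1)
  rw [real_inner_comm]
  norm_cast
  simp

/-- An affine minorant of `h` gives an affine minorant of its Moreau envelope. -/
theorem le_menv {h : G → EReal} {u : G} {c γ : ℝ} (hγ : 0 < γ)
    (hm : ∀ x, ((⟪x, u⟫ + c : ℝ) : EReal) ≤ h x) (x : G) :
    ((⟪x, u⟫ + (c - γ / 2 * ‖u‖ ^ 2) : ℝ) : EReal) ≤ menv γ h x := by
  refine le_iInf fun w => ?_
  refine le_trans ?_ (add_le_add (hm w) le_rfl)
  rw [← EReal.coe_add, EReal.coe_le_coe_iff]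
  have h1 := real_inner_le_norm (x - w) u
  have h2 : ‖x - w‖ ^ 2 / (2 * γ) + γ / 2 * ‖u‖ ^ 2 - ‖x - w‖ * ‖u‖
      = (‖x - w‖ - γ * ‖u‖) ^ 2 / (2 * γ) := by
    field_simp; ring
  have h3 : 0 ≤ (‖x - w‖ - γ * ‖u‖) ^ 2 / (2 * γ) := by positivity
  rw [inner_sub_left] at h1
  linarith

/-- A real-valued Moreau envelope of index `γ` is `(1 / γ)`-semiconcave. -/
theorem menv_semiconcave {h : G → EReal} {γ : ℝ} {e : G → ℝ}
    (hbot : ∀ w, h w ≠ ⊥) (he : ∀ x, menv γ h x = (e x : EReal)) (x y : G) {t : ℝ}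
    (ht0 : 0 < t) (ht1 : t < 1) :
    (1 - t) * e x + t * e y - t * (1 - t) / (2 * γ) * ‖x - y‖ ^ 2
      ≤ e ((1 - t) • x + t • y) := by
  rw [← EReal.coe_le_coe_iff, ← he]
  refine le_iInf fun w => ?_
  have hle : ∀ z, (e z : EReal) ≤ h w + ((‖z - w‖ ^ 2 / (2 * γ) : ℝ) : EReal) := fun z => by
    rw [← he]
    exact iInf_le (fun w : G => h w + ((‖z - w‖ ^ 2 / (2 * γ) : ℝ) : EReal)) w
  induction hw : h w with
  | bot => exact absurd hw (hbot w)
  | top => simp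
  | coe r =>
    rw [hw] at hle
    have hx := hle x
    have hy := hle y
    norm_cast at hx hy ⊢
    have e1 : (1 - t) • x + t • y - w = (1 - t) • (x - w) + t • (y - w) := by module
    have e2 : x - y = (x - w) - (y - w) := by abel
    have e3 : ‖(1 - t) • x + t • y - w‖ ^ 2
        = (1 - t) * ‖x - w‖ ^ 2 + t * ‖y - w‖ ^ 2 - t * (1 - t) * ‖x - y‖ ^ 2 := by
      rw [e1, e2, norm_add_sq_real, norm_sub_sq_real (x - w), norm_smul, norm_smul, mul_pow,
        mul_pow, Real.norm_eq_abs, Real.norm_eq_abs, sq_abs, sq_abs, real_inner_smul_left,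
        real_inner_smul_right]
      ring
    have hx' := mul_le_mul_of_nonneg_left hx (sub_nonneg.2 ht1.le)
    have hy' := mul_le_mul_of_nonneg_left hy ht0.le
    rw [e3]
    linear_combination hx' + hy'

end Envelope

/-- If `0 < ‖L‖ < 1` and `β = γ(1/‖L‖² − 1)`, then `L ⊚_γ g` is real-valued, convex, and
Fréchet differentiable with a `(1/β)`-Lipschitzian gradient. -/
theorem proxCocomp_differentiable_lipschitz_gradient
    {H G : Type*} [NormedAddCommGroup H] [InnerProductSpace ℝ H] [CompleteSpace H]
    [NormedAddCommGroup G] [InnerProductSpace ℝ G] [CompleteSpace G]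
    (L : H →L[ℝ] G) (hL0 : 0 < ‖L‖) (hL1 : ‖L‖ < 1)
    (g : G → EReal) (hg : ProperE g) (hm : HasAffMinorant g)
    (γ : ℝ) (hγ : 0 < γ) (β : ℝ) (hβ : β = γ * (1 / ‖L‖ ^ 2 - 1)) :
    ∃ f : H → ℝ, (∀ x : H, proxCocomp L γ g x = ((f x : ℝ) : EReal)) ∧
      ConvexOn ℝ Set.univ f ∧
      ∃ f' : H → H, (∀ x : H, HasGradientAt f (f' x) x) ∧
        LipschitzWith (Real.toNNReal (1 / β)) f' := by
  obtain ⟨⟨w₀, hw₀⟩, -⟩ := hg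
  obtain ⟨u, c, hm⟩ := hm
  have hL2 : ‖L‖ ^ 2 < 1 := by nlinarith
  have hβ0 : 0 < β := by
    rw [hβ]
    refine mul_pos hγ (sub_pos.2 ?_)
    rw [lt_div_iff₀ (by positivity)]
    linarith
  have hs : γ + β = γ / ‖L‖ ^ 2 := by rw [hβ]; ring
  have hminor := le_fconj_fconj hm
  have hbot : ∀ w, fconj (fconj g) w ≠ ⊥ := fun w h => by
    have := hminor w
    rw [h] at this
    exact absurd (le_bot_iff.1 this) (EReal.coe_ne_bot _)
  obtain ⟨r, hr⟩ : ∃ r : ℝ, fconj (fconj g) w₀ = r :=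
    ⟨_, (EReal.coe_toReal (fun h => hw₀ (top_le_iff.1 (h ▸ fconj_fconj_le g w₀)))
      (hbot w₀)).symm⟩
  have hupper : ∀ x, menv γ (fconj (fconj g)) x ≤
      ((r + ‖x - w₀‖ ^ 2 / (2 * γ) : ℝ) : EReal) := fun x => by
    rw [EReal.coe_add, ← hr]
    exact iInf_le (fun w : G => fconj (fconj g) w + ((‖x - w‖ ^ 2 / (2 * γ) : ℝ) : EReal)) w₀
  have hlower := le_menv hγ hminor
  obtain ⟨e, he⟩ : ∃ e : G → ℝ, ∀ x, menv γ (fconj (fconj g)) x = (e x : EReal) :=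
    ⟨fun x => (menv γ (fconj (fconj g)) x).toReal, fun x => (EReal.coe_toReal
      (ne_top_of_le_ne_top (EReal.coe_ne_top _) (hupper x))
      (ne_bot_of_le_ne_bot (EReal.coe_ne_bot _) (hlower x))).symm⟩
  simp only [he, EReal.coe_le_coe_iff] at hupper hlower
  have hnorm : ∀ z, ‖L z‖ ^ 2 / (2 * γ) ≤ ‖z‖ ^ 2 / (2 * (γ + β)) := fun z => by
    have h1 : ‖L z‖ ^ 2 ≤ ‖L‖ ^ 2 * ‖z‖ ^ 2 := by
      rw [← mul_pow]
      exact pow_le_pow_left₀ (norm_nonneg _) (L.le_opNorm z) 2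
    have h2 : ‖z‖ ^ 2 / (2 * (γ + β)) = ‖L‖ ^ 2 * ‖z‖ ^ 2 / (2 * γ) := by
      rw [hs]; field_simp
    rw [h2]
    gcongr
  have hsemi : ∀ x y : H, ∀ t : ℝ, 0 < t → t < 1 →
      (1 - t) * e (L x) + t * e (L y) - t * (1 - t) / (2 * (γ + β)) * ‖x - y‖ ^ 2
        ≤ e (L ((1 - t) • x + t • y)) := fun x y t ht0 ht1 => by
    have h1 := menv_semiconcave hbot he (L x) (L y) ht0 ht1
    have h2 := mul_le_mul_of_nonneg_left (hnorm (x - y))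
      (mul_nonneg ht0.le (sub_nonneg.2 ht1.le))
    rw [map_add, map_smul, map_smul]
    rw [map_sub] at h2
    linear_combination h1 + h2
  have hne : (conjEpi fun z => e (L z)).Nonempty :=
    ⟨(L.adjoint u, -(c - γ / 2 * ‖u‖ ^ 2)), fun z => by
      have := hlower (L z)
      simp only [ContinuousLinearMap.adjoint_inner_right]
      linarith⟩
  have hgrowth : ∀ z, e (L z) ≤ ‖z‖ ^ 2 / (2 * (γ + β)) + ⟪z, -((1 / γ) • L.adjoint w₀)⟫
      + (r + ‖w₀‖ ^ 2 / (2 * γ)) := fun z => by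
    have h1 := hupper (L z)
    have h2 := hnorm z
    rw [norm_sub_sq_real] at h1
    rw [inner_neg_right, real_inner_smul_right, ContinuousLinearMap.adjoint_inner_right]
    have h3 : (‖L z‖ ^ 2 - 2 * ⟪L z, w₀⟫ + ‖w₀‖ ^ 2) / (2 * γ)
        = ‖L z‖ ^ 2 / (2 * γ) - 1 / γ * ⟪L z, w₀⟫ + ‖w₀‖ ^ 2 / (2 * γ) := by
      field_simp
    linarith
  refine ⟨conjSubQuad (fun z => e (L z)) γ, fun x => ?_,
    conjSubQuad_convex_and_lipschitz_gradient hγ hβ0 hsemi hne hgrowth⟩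
  rw [← fconj_fconj_sub_quad_eq hγ hβ0 hne hgrowth]
  unfold proxCocomp proxComp
  simp only [one_div_one_div, he]
end
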